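/- arXiv:2510.21174 — 3 statements merged into one kernel-verified Lean document; each statement's English description precedes it below -/
import Mathlib

section
/- Let K and L be positive integers and let (X_i)_{i≥1} be an i.i.d. sequence of random vectors in ℝ^K. Suppose g_1, …, g_L ∈ ℝ^K are points such that the origin lies in the topological interior of the convex hull of {g_1, …, g_L}, and q_a := P(X_1 = g_a) > 0 for every a = 1, …, L. Put q = ∏_{a=1}^L q_a. Then for every n ≥ L, the probability that the origin does not lie in the interior of the convex hull of {X_1, …, X_n} is at most (1 − q)^{⌊n/L⌋}. -/
open MeasureTheory ProbabilityTheory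

/-- Events built from disjoint groups of independent random variables are independent. -/
lemma iIndepSet_iInter_preimage_of_iIndepFun_prod {Ω ι κ E : Type*} [MeasurableSpace Ω]
    [MeasurableSpace E] [Fintype κ] {P : Measure Ω} {Y : ι × κ → Ω → E}
    (hmeas : ∀ p, Measurable (Y p)) (hY : iIndepFun Y P) {s : κ → Set E}
    (hs : ∀ j, MeasurableSet (s j)) :
    iIndepSet (fun i => ⋂ j, Y (i, j) ⁻¹' s j) P := by
  have hmul := hY.measure_inter_preimage_eq_mul
  have hfactor (i : ι) : P (⋂ j, Y (i, j) ⁻¹' s j) = ∏ j, P (Y (i, j) ⁻¹' s j) := by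
    simpa using hmul (({i} : Finset ι) ×ˢ Finset.univ) (sets := fun p => s p.2)
      fun p _ => hs p.2
  rw [iIndepSet_iff_meas_biInter fun i => .iInter fun j => hmeas _ (hs j)]
  intro S
  simp_rw [hfactor]
  rw [← Finset.prod_product', ← hmul _ (sets := fun p => s p.2) fun p _ => hs p.2]
  congr 1
  ext ω
  simp only [Set.mem_iInter, Finset.mem_product, Finset.mem_univ, and_true, Prod.forall]
  exact forall_congr' fun _ => forall_comm

/-- The probability that none of `m` independent events of common probability `c` occurs. -/
lemma measureReal_iInter_compl_of_iIndepSet {Ω : Type*} [MeasurableSpace Ω] {P : Measure Ω}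
    [IsProbabilityMeasure P] {m : ℕ} {A : Fin m → Set Ω} (hA : ∀ i, MeasurableSet (A i))
    (hind : iIndepSet A P) {c : ℝ} (hc : ∀ i, P.real (A i) = c) :
    P.real (⋂ i, (A i)ᶜ) = (1 - c) ^ m := by
  have hprod : P (⋂ i, (A i)ᶜ) = ∏ i, P ((A i)ᶜ) :=
    iIndep.meas_iInter hind fun i =>
      (MeasurableSpace.measurableSet_generateFrom (Set.mem_singleton (A i))).compl
  rw [measureReal_def, hprod, ENNReal.toReal_prod]
  simp_rw [← measureReal_def, probReal_compl_eq_one_sub (hA _), hc]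
  simp

/-- Blocking bound: for an i.i.d. sequence `X` in `ℝ^K`, if points
`g 1, …, g L` have the origin in the interior of their convex hull and each value `g a`
is attained with probability `q a > 0`, then for `n ≥ L` the probability that the origin
is not in the interior of the convex hull of `X 1, …, X n` is at most
`(1 - ∏ q a) ^ ⌊n / L⌋`. -/
theorem stmt0 {K L : ℕ} (hK : 0 < K) (hL : 0 < L)
    {Ω : Type*} [MeasurableSpace Ω] {P : Measure Ω} [IsProbabilityMeasure P]
    (X : ℕ → Ω → EuclideanSpace ℝ (Fin K))
    (hmeas : ∀ i, Measurable (X i))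
    (hindep : iIndepFun X P)
    (hident : ∀ i, IdentDistrib (X i) (X 0) P P)
    (g : Fin L → EuclideanSpace ℝ (Fin K))
    (hg : (0 : EuclideanSpace ℝ (Fin K)) ∈ interior (convexHull ℝ (Set.range g)))
    (q : Fin L → ℝ)
    (hq : ∀ a, q a = (P {ω | X 0 ω = g a}).toReal)
    (hqpos : ∀ a, 0 < q a)
    (n : ℕ) (hn : L ≤ n) :
    (P {ω | (0 : EuclideanSpace ℝ (Fin K)) ∉
        interior (convexHull ℝ (Set.range fun i : Fin n => X i ω))}).toReal
      ≤ (1 - ∏ a, q a) ^ (n / L) := by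
  let Y : Fin (n / L) × Fin L → Ω → EuclideanSpace ℝ (Fin K) := fun p => X (finProdFinEquiv p)
  have hYmeas p : Measurable (Y p) := hmeas _
  have hY : iIndepFun Y P :=
    hindep.precomp (g := fun p : Fin (n / L) × Fin L => (finProdFinEquiv p : ℕ))
      (Fin.val_injective.comp finProdFinEquiv.injective)
  let A : Fin (n / L) → Set Ω := fun b => ⋂ a, Y (b, a) ⁻¹' {g a}
  have hs (a : Fin L) : MeasurableSet ({g a} : Set (EuclideanSpace ℝ (Fin K))) :=
    measurableSet_singleton _
  have hA b : MeasurableSet (A b) := .iInter fun a => hYmeas _ (hs a)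
  have hYq b a : P (Y (b, a) ⁻¹' {g a}) = P {ω | X 0 ω = g a} :=
    (hident _).measure_mem_eq (hs a)
  have hAq b : P.real (A b) = ∏ a, q a := by
    have hinj : Function.Injective fun a : Fin L => (b, a) := Prod.mk_right_injective b
    have hAprod : P (A b) = ∏ a, P (Y (b, a) ⁻¹' {g a}) :=
      (hY.precomp hinj).meas_iInter fun a => ⟨_, hs a, rfl⟩
    rw [measureReal_def, hAprod, ENNReal.toReal_prod]
    simp_rw [hYq, hq]
  rw [← measureReal_iInter_compl_of_iIndepSet hA
    (iIndepSet_iInter_preimage_of_iIndepFun_prod hYmeas hY hs) hAq]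
  refine measureReal_mono fun ω hω => Set.mem_iInter.2 fun b hb => hω ?_
  refine interior_mono (convexHull_mono ?_) hg
  rintro _ ⟨a, rfl⟩
  exact ⟨⟨finProdFinEquiv (b, a), (Fin.is_lt _).trans_le (Nat.div_mul_le_self n L)⟩,
    Set.mem_iInter.1 hb a⟩
end

section
/- Let K and L be positive integers and let (X_i)_{i≥1} be an i.i.d. sequence of random vectors in ℝ^K. Let G_1, …, G_L be Borel subsets of ℝ^K such that P(X_1 ∈ G_a) > 0 for every a = 1, …, L, and such that for every choice of points g_a ∈ G_a (a = 1, …, L) the origin lies in the topological interior of the convex hull of {g_1, …, g_L}. Then ∑_{n=1}^∞ P(the origin does not lie in the interior of the convex hull of {X_1, …, X_n}) < ∞, and consequently, almost surely the origin lies in the interior of the convex hull of {X_1, …, X_n} for all sufficiently large n. -/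
open MeasureTheory ProbabilityTheory

/-- For an i.i.d. sequence, the probability that the first `n` terms all lie in a measurable
set `S` is the `n`-th power of the probability that the first one does. -/
lemma measure_forall_lt_mem_eq_pow {Ω E : Type*} [MeasurableSpace Ω] [MeasurableSpace E]
    {P : Measure Ω} {X : ℕ → Ω → E} (hindep : iIndepFun X P)
    (hident : ∀ i, IdentDistrib (X i) (X 0) P P) {S : Set E} (hS : MeasurableSet S) (n : ℕ) :
    P {ω | ∀ i < n, X i ω ∈ S} = P {ω | X 0 ω ∈ S} ^ n := by
  have hset : {ω | ∀ i < n, X i ω ∈ S} = ⋂ i ∈ Finset.range n, X i ⁻¹' S := by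
    ext ω
    simp
  rw [hset, hindep.measure_inter_preimage_eq_mul (Finset.range n) fun _ _ => hS,
    Finset.prod_congr rfl fun i _ => (hident i).measure_mem_eq hS, Finset.prod_const,
    Finset.card_range]
  rfl

/-- For an i.i.d. sequence and a measurable set of positive probability, the probabilities that
the first `n` terms all miss the set are summable. -/
lemma tsum_measure_forall_lt_notMem_lt_top {Ω E : Type*} [MeasurableSpace Ω] [MeasurableSpace E]
    {P : Measure Ω} [IsProbabilityMeasure P] {X : ℕ → Ω → E} (hmeas : Measurable (X 0))
    (hindep : iIndepFun X P) (hident : ∀ i, IdentDistrib (X i) (X 0) P P)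
    {S : Set E} (hS : MeasurableSet S) (hpos : 0 < P {ω | X 0 ω ∈ S}) :
    ∑' n : ℕ, P {ω | ∀ i < n, X i ω ∉ S} < ⊤ := by
  have hlt : P {ω | X 0 ω ∈ Sᶜ} < 1 := by
    have hcompl : P {ω | X 0 ω ∈ Sᶜ} = 1 - P {ω | X 0 ω ∈ S} :=
      prob_compl_eq_one_sub (hmeas hS)
    rw [hcompl]
    exact ENNReal.sub_lt_self ENNReal.one_ne_top one_ne_zero hpos.ne'
  have hpow : ∀ n, P {ω | ∀ i < n, X i ω ∉ S} = P {ω | X 0 ω ∈ Sᶜ} ^ n :=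
    measure_forall_lt_mem_eq_pow hindep hident hS.compl
  simp_rw [hpow, ENNReal.tsum_geometric]
  exact ENNReal.inv_lt_top.2 (tsub_pos_of_lt hlt)

/-- If the origin is interior to the convex hull of every selection from the sets `G a`, then
a family whose convex hull does not have the origin in its interior misses some `G a`. -/
lemma exists_forall_notMem_of_zero_notMem_interior_convexHull {ι κ E : Type*}
    [AddCommGroup E] [Module ℝ E] [TopologicalSpace E] {G : ι → Set E}
    (hG : ∀ g : ι → E, (∀ a, g a ∈ G a) → (0 : E) ∈ interior (convexHull ℝ (Set.range g)))
    {x : κ → E} (hx : (0 : E) ∉ interior (convexHull ℝ (Set.range x))) :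
    ∃ a, ∀ i, x i ∉ G a := by
  contrapose! hx
  choose i hi using hx
  exact interior_mono (convexHull_mono (Set.range_comp_subset_range i x)) (hG (x ∘ i) hi)


open MeasureTheory ProbabilityTheory

/-- (Lemma 1 of the paper.) For an i.i.d. sequence `X` in `ℝ^K` and Borel
sets `G 1, …, G L`, each charged with positive probability, such that every selection of
points `g a ∈ G a` has the origin in the interior of its convex hull, the probabilities of
the events "the origin is not in the interior of the convex hull of `X 1, …, X n`" are
summable; consequently, almost surely the origin lies in the interior of the convex hull
of `X 1, …, X n` for all sufficiently large `n`. -/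
theorem stmt1 {K L : ℕ} (hK : 0 < K) (hL : 0 < L)
    {Ω : Type*} [MeasurableSpace Ω] {P : Measure Ω} [IsProbabilityMeasure P]
    (X : ℕ → Ω → EuclideanSpace ℝ (Fin K))
    (hmeas : ∀ i, Measurable (X i))
    (hindep : iIndepFun X P)
    (hident : ∀ i, IdentDistrib (X i) (X 0) P P)
    (G : Fin L → Set (EuclideanSpace ℝ (Fin K)))
    (hGmeas : ∀ a, MeasurableSet (G a))
    (hGpos : ∀ a, 0 < P {ω | X 0 ω ∈ G a})
    (hGhull : ∀ g : Fin L → EuclideanSpace ℝ (Fin K), (∀ a, g a ∈ G a) →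
      (0 : EuclideanSpace ℝ (Fin K)) ∈ interior (convexHull ℝ (Set.range g))) :
    (∑' n : ℕ, P {ω | (0 : EuclideanSpace ℝ (Fin K)) ∉
        interior (convexHull ℝ (Set.range fun i : Fin n => X i ω))}) < ⊤ ∧
    (∀ᵐ ω ∂P, ∀ᶠ n in Filter.atTop,
      (0 : EuclideanSpace ℝ (Fin K)) ∈
        interior (convexHull ℝ (Set.range fun i : Fin n => X i ω))) := by
  have hsum : (∑' n : ℕ, P {ω | (0 : EuclideanSpace ℝ (Fin K)) ∉
      interior (convexHull ℝ (Set.range fun i : Fin n => X i ω))}) < ⊤ := by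
    calc _ ≤ ∑' n : ℕ, ∑ a, P {ω | ∀ i < n, X i ω ∉ G a} := by
          refine ENNReal.tsum_le_tsum fun n => ?_
          refine (measure_mono fun ω hω => ?_).trans (measure_iUnion_fintype_le P _)
          obtain ⟨a, ha⟩ := exists_forall_notMem_of_zero_notMem_interior_convexHull hGhull hω
          exact Set.mem_iUnion.2 ⟨a, fun i hi => ha ⟨i, hi⟩⟩
      _ = ∑ a, ∑' n : ℕ, P {ω | ∀ i < n, X i ω ∉ G a} :=
          Summable.tsum_finsetSum fun _ _ => ENNReal.summable
      _ < ⊤ := ENNReal.sum_lt_top.2 fun a _ =>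
          tsum_measure_forall_lt_notMem_lt_top (hmeas 0) hindep hident (hGmeas a) (hGpos a)
  refine ⟨hsum, ?_⟩
  filter_upwards [ae_eventually_notMem hsum.ne] with ω hω
  exact hω.mono fun n hn => not_not.1 hn
end

section
/- Let (Z, 𝒵) be a measurable space and (Z_i)_{i≥1} an i.i.d. sequence of Z-valued random elements. Let Θ be a nonempty bounded subset of ℝ^p, let b > 0, and let h : Z × ℝ^p → ℝ^K be such that z ↦ h(z, θ) is measurable for each θ and ‖h(z, θ) − h(z, θ')‖ ≤ b‖θ − θ'‖ for all θ, θ' ∈ Θ and all z ∈ Z. Suppose there exist d > 0, q > 0, and a positive integer L such that for every θ ∈ Θ there are points g_{1,θ}, …, g_{L,θ} ∈ ℝ^K with the closed ball of radius d centered at the origin contained in the convex hull of {g_{1,θ}, …, g_{L,θ}}, and with P(h(Z_1, θ) = g_{a,θ}) ≥ q for every a = 1, …, L. Then, almost surely, there exists N such that for all n ≥ N and all θ ∈ Θ simultaneously, the origin lies in the topological interior of the convex hull of {h(Z_1, θ), …, h(Z_n, θ)}. -/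
open MeasureTheory ProbabilityTheory

open Metric in
/-- If every point of a family whose convex hull contains the closed ball of radius `d` is
`ε`-close to a point of a finite family, `ε < d`, then the origin is interior to the convex hull
of the finite family. -/
theorem zero_mem_interior_convexHull_of_closedBall_subset {E ι κ : Type*}
    [NormedAddCommGroup E] [InnerProductSpace ℝ E] [CompleteSpace E] [Finite κ]
    {x : ι → E} {y : κ → E} {d ε : ℝ} (hd : 0 < d) (hε : ε < d)
    (hx : closedBall (0 : E) d ⊆ convexHull ℝ (Set.range x))
    (hxy : ∀ a, ∃ i, ‖x a - y i‖ ≤ ε) :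
    (0 : E) ∈ interior (convexHull ℝ (Set.range y)) := by
  set C := convexHull ℝ (Set.range y)
  have hsub : ∀ v ∈ closedBall (0 : E) d, ∃ c ∈ C, ‖v - c‖ ≤ ε := by
    have hmin : convexHull ℝ (Set.range x) ⊆ {v | ∃ c ∈ C, ‖v - c‖ ≤ ε} := by
      refine convexHull_min ?_ ?_
      · rintro _ ⟨a, rfl⟩
        obtain ⟨i, hi⟩ := hxy a
        exact ⟨y i, subset_convexHull ℝ _ ⟨i, rfl⟩, hi⟩
      · rintro v ⟨c, hc, hvc⟩ w ⟨e, he, hwe⟩ s t hs ht hst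
        refine ⟨s • c + t • e, convex_convexHull ℝ _ hc he hs ht hst, ?_⟩
        have h1 := convex_closedBall (0 : E) ε (mem_closedBall_zero_iff.2 hvc)
          (mem_closedBall_zero_iff.2 hwe) hs ht hst
        rw [mem_closedBall_zero_iff] at h1
        rwa [show s • v + t • w - (s • c + t • e) = s • (v - c) + t • (w - e) by module]
    exact fun v hv => hmin (hx hv)
  have hclosed : IsClosed C := ((Set.finite_range y).isCompact_convexHull ℝ).isClosed
  refine mem_interior.2 ⟨ball 0 (d - ε), fun u hu => ?_, isOpen_ball, mem_ball_self (by linarith)⟩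
  by_contra huC
  obtain ⟨f, s, hfs, hsu⟩ :=
    geometric_hahn_banach_closed_point (convex_convexHull ℝ (Set.range y)) hclosed huC
  obtain ⟨v, rfl⟩ := (InnerProductSpace.toDual ℝ E).surjective f
  simp only [InnerProductSpace.toDual_apply_apply] at hfs hsu
  rw [mem_ball_zero_iff] at hu
  have hv : 0 < ‖v‖ := by
    refine norm_pos_iff.2 fun hv => ?_
    obtain ⟨c, hc, -⟩ := hsub 0 (mem_closedBall_self hd.le)
    have h1 := hfs c hc
    simp only [hv, inner_zero_left] at h1 hsu
    linarith
  obtain ⟨c, hc, hcε⟩ := hsub ((d / ‖v‖) • v) (by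
    rw [mem_closedBall_zero_iff, norm_smul, Real.norm_of_nonneg (by positivity),
      div_mul_cancel₀ _ hv.ne'])
  have h1 := hfs c hc
  have h2 := real_inner_le_norm v u
  have h3 := real_inner_le_norm v ((d / ‖v‖) • v - c)
  rw [inner_sub_right, inner_smul_right, real_inner_self_eq_norm_sq] at h3
  have h4 : d / ‖v‖ * ‖v‖ ^ 2 = ‖v‖ * d := by field_simp
  have h5 := mul_le_mul_of_nonneg_left hcε hv.le
  have h6 := mul_lt_mul_of_pos_left hu hv
  rw [h4] at h3
  linarith

/-- An i.i.d. sequence almost surely visits every measurable set of positive probability. -/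
theorem ae_exists_mem_of_iIndepFun_identDistrib {Ω Z : Type*} [MeasurableSpace Ω]
    [MeasurableSpace Z] {P : Measure Ω} {X : ℕ → Ω → Z} (hmeas : ∀ i, Measurable (X i))
    (hindep : iIndepFun X P) (hident : ∀ i, IdentDistrib (X i) (X 0) P P)
    {B : Set Z} (hB : MeasurableSet B) (hpos : P (X 0 ⁻¹' B) ≠ 0) :
    ∀ᵐ ω ∂P, ∃ i, X i ω ∈ B := by
  have := hindep.isProbabilityMeasure
  have hset : iIndepSet (fun i => X i ⁻¹' B) P := by
    rw [iIndepSet_iff_meas_biInter fun i => hmeas i hB]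
    exact fun s => hindep.measure_inter_preimage_eq_mul s fun _ _ => hB
  have hsum : ∑' i, P (X i ⁻¹' B) = ⊤ := by
    simp_rw [fun i => (hident i).measure_mem_eq hB]
    exact ENNReal.tsum_const_eq_top_of_ne_zero hpos
  have hlim := measure_limsup_eq_one (fun i => hmeas i hB) hset hsum
  have hms : MeasurableSet (Filter.limsup (fun i => X i ⁻¹' B) Filter.atTop) :=
    MeasurableSet.measurableSet_limsup fun i => hmeas i hB
  filter_upwards [(mem_ae_iff_prob_eq_one hms).2 hlim] with ω hω
  exact (Filter.mem_limsup_iff_frequently_mem.1 hω).exists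

/-- (Lemma 2 of the paper.) Let `Zseq` be an i.i.d. sequence in a measurable
space `Z`, let `Θ ⊆ ℝ^p` be nonempty and bounded, and let `h : Z → ℝ^p → ℝ^K` be measurable
in `z` for each `θ` and uniformly `b`-Lipschitz in `θ` on `Θ`. Suppose there are `d > 0`,
`q > 0`, `L` and, for each `θ ∈ Θ`, points `g θ 1, …, g θ L` whose convex hull contains the
closed ball of radius `d` about the origin, each attained by `h(Z₁, θ)` with probability at
least `q`. Then, almost surely, the origin eventually lies in the interior of the convex hull
of `h(Z₁, θ), …, h(Zₙ, θ)` for all `θ ∈ Θ` simultaneously. -/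
theorem stmt4 {p K L : ℕ} (hK : 0 < K) (hL : 0 < L)
    {Z : Type*} [MeasurableSpace Z]
    {Ω : Type*} [MeasurableSpace Ω] {P : Measure Ω} [IsProbabilityMeasure P]
    (Zseq : ℕ → Ω → Z)
    (hmeas : ∀ i, Measurable (Zseq i))
    (hindep : iIndepFun Zseq P)
    (hident : ∀ i, IdentDistrib (Zseq i) (Zseq 0) P P)
    (Θ : Set (EuclideanSpace ℝ (Fin p))) (hΘne : Θ.Nonempty)
    (hΘbd : Bornology.IsBounded Θ)
    (b : ℝ) (hb : 0 < b)
    (h : Z → EuclideanSpace ℝ (Fin p) → EuclideanSpace ℝ (Fin K))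
    (hhmeas : ∀ θ, Measurable fun z => h z θ)
    (hlip : ∀ z : Z, ∀ θ ∈ Θ, ∀ θ' ∈ Θ, ‖h z θ - h z θ'‖ ≤ b * ‖θ - θ'‖)
    (d q : ℝ) (hd : 0 < d) (hq : 0 < q)
    (g : EuclideanSpace ℝ (Fin p) → Fin L → EuclideanSpace ℝ (Fin K))
    (hghull : ∀ θ ∈ Θ, Metric.closedBall (0 : EuclideanSpace ℝ (Fin K)) d ⊆
      convexHull ℝ (Set.range (g θ)))
    (hgprob : ∀ θ ∈ Θ, ∀ a : Fin L,
      ENNReal.ofReal q ≤ P {ω | h (Zseq 0 ω) θ = g θ a}) :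
    ∀ᵐ ω ∂P, ∃ N : ℕ, ∀ n ≥ N, ∀ θ ∈ Θ,
      (0 : EuclideanSpace ℝ (Fin K)) ∈
        interior (convexHull ℝ (Set.range fun i : Fin n => h (Zseq i ω) θ)) := by
  obtain ⟨T, hTΘ, hTfin, hcover⟩ := Metric.finite_approx_of_totallyBounded
    (hΘbd.isCompact_closure.totallyBounded.subset subset_closure) (d / (2 * b)) (by positivity)
  have hvisit : ∀ᵐ ω ∂P, ∀ t ∈ T, ∀ a, ∃ i, h (Zseq i ω) t = g t a := by
    refine (ae_ball_iff hTfin.countable).2 fun t ht => ae_all_iff.2 fun a => ?_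
    exact ae_exists_mem_of_iIndepFun_identDistrib hmeas hindep hident
      (hhmeas t (measurableSet_singleton (g t a)))
      ((ENNReal.ofReal_pos.2 hq).trans_le (hgprob t (hTΘ ht) a)).ne'
  filter_upwards [hvisit] with ω hω
  have hev : ∀ᶠ n in Filter.atTop, ∀ t ∈ T, ∀ a, ∃ i : Fin n, h (Zseq i ω) t = g t a := by
    refine (Filter.eventually_all_finite hTfin).2 fun t ht => Filter.eventually_all.2 fun a => ?_
    obtain ⟨i, hi⟩ := hω t ht a
    filter_upwards [Filter.eventually_gt_atTop i] with n hn
    exact ⟨⟨i, hn⟩, hi⟩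
  obtain ⟨N, hN⟩ := Filter.eventually_atTop.1 hev
  refine ⟨N, fun n hn θ hθ => ?_⟩
  obtain ⟨t, ht, hθt⟩ := Set.mem_iUnion₂.1 (hcover hθ)
  refine zero_mem_interior_convexHull_of_closedBall_subset hd (half_lt_self hd)
    (hghull t (hTΘ ht)) fun a => ?_
  obtain ⟨i, hi⟩ := hN n hn t ht a
  refine ⟨i, ?_⟩
  rw [← hi]
  refine (hlip _ t (hTΘ ht) θ hθ).trans ?_
  rw [Metric.mem_ball', dist_eq_norm] at hθt
  calc b * ‖t - θ‖ ≤ b * (d / (2 * b)) := by gcongr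
    _ = d / 2 := by field_simp
end
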